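/- arXiv:2003.09661 — 9 statements merged into one kernel-verified Lean document; each statement's English description precedes it below -/
import Mathlib

section
/- Let Θ be a finite set with |Θ| ≥ 2 and let u be a non-exclusive degree on Θ. Let U be the (2^|Θ|−1)×(2^|Θ|−1) real symmetric matrix whose rows and columns are indexed by the nonempty subsets of Θ and whose (B,C)-entry is u(B,C). Then U has full rank 2^|Θ|−1 if and only if u(A, Θ∖A) ≠ 1 for every nonempty subset A ⊆ Θ. -/
open Matrix in
/-- A square matrix over a field has full rank iff its determinant is nonzero. -/
theorem Matrix.rank_eq_card_iff_det_ne_zero {n K : Type*} [Fintype n] [DecidableEq n] [Field K]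
    (A : Matrix n n K) : A.rank = Fintype.card n ↔ A.det ≠ 0 := by
  refine ⟨fun h => ?_, rank_of_det_ne_zero⟩
  rw [← isUnit_iff_ne_zero, ← isUnit_iff_isUnit_det, ← linearIndependent_cols_iff_isUnit,
    linearIndependent_iff_card_eq_finrank_span, ← h, rank_eq_finrank_span_cols, Set.finrank]

open Matrix in
/-- The determinant of a matrix indexed by a finite partial order whose nonzero entries all lie
weakly above the diagonal. -/
theorem Matrix.det_eq_prod_diag_of_forall_not_le {n R : Type*} [Fintype n] [DecidableEq n]
    [PartialOrder n] [CommRing R] (M : Matrix n n R) (h : ∀ i j, ¬ i ≤ j → M i j = 0) :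
    M.det = ∏ i, M i i := by
  let e : LinearExtension n ≃ n := Equiv.refl _
  let : Fintype (LinearExtension n) := Fintype.ofEquiv n e.symm
  have htri : (M.submatrix e e).IsUpperTriangular := fun i j hji =>
    h (e i) (e j) fun hij =>
      have hle : toLinearExtension (e i) ≤ toLinearExtension (e j) :=
        toLinearExtension.monotone hij
      not_le_of_gt hji hle
  rw [← det_submatrix_equiv_self e, det_of_isUpperTriangular htri]
  exact e.prod_comp fun i => M i i

/-- Bordering the matrix of `1 - u` by the empty set changes its determinant only by a sign. -/
theorem Matrix.det_ne_zero_iff_det_one_sub_ne_zero {Θ R : Type*} [Fintype Θ] [DecidableEq Θ]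
    [CommRing R] (u : Finset Θ → Finset Θ → R) (hu : ∀ A, u A ∅ = 0 ∧ u ∅ A = 0) :
    (Matrix.of fun B C : {A : Finset Θ // A.Nonempty} => u B.1 C.1).det ≠ 0 ↔
      (Matrix.of fun B C : Finset Θ => 1 - u B C).det ≠ 0 := by
  have hempty (B : {A : Finset Θ // ¬ A.Nonempty}) : B.1 = ∅ :=
    Finset.not_nonempty_iff_eq_empty.1 B.2
  have : Unique {A : Finset Θ // ¬ A.Nonempty} :=
    { default := ⟨∅, Finset.not_nonempty_empty⟩
      uniq := fun B => Subtype.ext (hempty B) }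
  have hone : (Matrix.of fun B C : Finset Θ => 1 - u B C).toBlock
      (fun A => ¬ A.Nonempty) (fun A => ¬ A.Nonempty) = 1 := by
    ext B C
    obtain rfl := Subsingleton.elim B C
    simp [Matrix.toBlock_apply, hempty, hu]
  rw [Matrix.det_toBlock _ (fun A : Finset Θ => A.Nonempty), hone, Matrix.det_fromBlocks_one₂₂]
  have hneg : (Matrix.of fun B C : Finset Θ => 1 - u B C).toBlock
      (fun A => A.Nonempty) (fun A => A.Nonempty) -
      (Matrix.of fun B C : Finset Θ => 1 - u B C).toBlock
        (fun A => A.Nonempty) (fun A => ¬ A.Nonempty) *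
      (Matrix.of fun B C : Finset Θ => 1 - u B C).toBlock
        (fun A => ¬ A.Nonempty) (fun A => A.Nonempty) =
      -(Matrix.of fun B C : {A : Finset Θ // A.Nonempty} => u B.1 C.1) := by
    ext B C
    simp [Matrix.mul_apply, Matrix.toBlock_apply, hempty, hu]
  rw [hneg, Matrix.det_neg, ne_eq, ne_eq, ((isUnit_one.neg).pow _).mul_right_eq_zero]

/-- If `u` equals `1` on intersecting pairs, the matrix of `1 - u` becomes triangular after
complementing its column indices. -/
theorem Matrix.det_one_sub_ne_zero_iff {Θ K : Type*} [Fintype Θ] [DecidableEq Θ] [Field K]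
    (u : Finset Θ → Finset Θ → K) (hu : ∀ B C : Finset Θ, (B ∩ C).Nonempty → u B C = 1) :
    (Matrix.of fun B C : Finset Θ => 1 - u B C).det ≠ 0 ↔ ∀ A, u A Aᶜ ≠ 1 := by
  have hdet : ((Matrix.of fun B C : Finset Θ => 1 - u B C).submatrix id
      (Function.Involutive.toPerm Compl.compl (compl_involutive (α := Finset Θ)))).det =
      ∏ A : Finset Θ, (1 - u A Aᶜ) := by
    rw [Matrix.det_eq_prod_diag_of_forall_not_le]
    · rfl
    · intro B C hBC
      have : (B ∩ Cᶜ).Nonempty := by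
        rwa [← Finset.sdiff_eq_inter_compl, Finset.sdiff_nonempty]
      simp [hu _ _ this]
  have hsign (σ : Equiv.Perm (Finset Θ)) : IsUnit ((Equiv.Perm.sign σ : ℤ) : K) :=
    (Equiv.Perm.sign σ).isUnit.map (Int.castRingHom K)
  rw [Matrix.det_permute'] at hdet
  rw [ne_eq, ← (hsign _).mul_right_eq_zero, hdet, Finset.prod_eq_zero_iff]
  simp [sub_eq_zero, eq_comm (a := (1 : K))]

/-- For a finite set `Θ` with `|Θ| ≥ 2` and a non-exclusive degree `u` on `Θ`,
the `(2^|Θ|−1) × (2^|Θ|−1)` symmetric matrix `U` with entries `u(B,C)`, indexed by the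
nonempty subsets of `Θ`, has full rank `2^|Θ|−1` if and only if `u(A, Θ∖A) ≠ 1` for every
nonempty subset `A ⊆ Θ`. -/
theorem stmt_0 {Θ : Type*} [Fintype Θ] [DecidableEq Θ]
    (hcard : 2 ≤ Fintype.card Θ)
    (u : Finset Θ → Finset Θ → ℝ)
    (hRange : ∀ B C : Finset Θ, u B C ∈ Set.Icc (0 : ℝ) 1)
    (hP1 : ∀ B C : Finset Θ, (B ∩ C).Nonempty → u B C = 1)
    (hP2 : ∀ B C : Finset Θ, u B C = u C B)
    (hP3 : ∀ A B C : Finset Θ, B ⊆ C → u A B ≤ u A C)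
    (hP4 : ∀ A B C : Finset Θ, u A (B ∪ C) ≤ u A B + u A C)
    (hP5 : ∀ A : Finset Θ, u A ∅ = 0 ∧ u ∅ A = 0)
    (U : Matrix {A : Finset Θ // A.Nonempty} {A : Finset Θ // A.Nonempty} ℝ)
    (hU : ∀ B C : {A : Finset Θ // A.Nonempty}, U B C = u B.1 C.1) :
    U.rank = 2 ^ Fintype.card Θ - 1 ↔
      ∀ A : Finset Θ, A.Nonempty → u A Aᶜ ≠ 1 := by
  obtain rfl : U = Matrix.of fun B C => u B.1 C.1 := Matrix.ext hU
  have hcardU : Fintype.card {A : Finset Θ // A.Nonempty} = 2 ^ Fintype.card Θ - 1 := by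
    simp [Finset.nonempty_iff_ne_empty, Fintype.card_subtype_compl]
  rw [← hcardU, Matrix.rank_eq_card_iff_det_ne_zero,
    Matrix.det_ne_zero_iff_det_one_sub_ne_zero u hP5, Matrix.det_one_sub_ne_zero_iff u hP1]
  refine ⟨fun h A _ => h A, fun h A => ?_⟩
  rcases A.eq_empty_or_nonempty with rfl | hA
  · simp [hP5]
  · exact h A hA
end

section
/- Let Θ be a finite nonempty set and let R assign to each pair of elements θi, θj ∈ Θ a real number R(θi,θj) ∈ [0,1] with R(θi,θj) = R(θj,θi) and R(θ,θ) = 1 for all θ, θi, θj ∈ Θ. Define u(B,C) = max_{θi∈B, θj∈C} R(θi,θj) for nonempty B, C ⊆ Θ, and u(B,∅) = u(∅,C) = u(∅,∅) = 0. Then u is a non-exclusive degree on Θ, i.e., it satisfies properties (P1)–(P5). -/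
/-- If `R` is a symmetric, reflexive, `[0,1]`-valued fuzzy relation on a finite
nonempty set `Θ`, and `u(B,C) = max_{θi ∈ B, θj ∈ C} R(θi,θj)` for nonempty `B, C ⊆ Θ` with
`u(B,∅) = u(∅,C) = 0`, then `u` is a non-exclusive degree on `Θ`, i.e. it satisfies
(P1)–(P5) and takes values in `[0,1]`. -/
theorem stmt_1 {Θ : Type*} [Fintype Θ] [DecidableEq Θ] [Nonempty Θ]
    (R : Θ → Θ → ℝ)
    (hRrange : ∀ x y : Θ, R x y ∈ Set.Icc (0 : ℝ) 1)
    (hRsymm : ∀ x y : Θ, R x y = R y x)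
    (hRrefl : ∀ x : Θ, R x x = 1)
    (u : Finset Θ → Finset Θ → ℝ)
    (hu : ∀ (B C : Finset Θ) (hB : B.Nonempty) (hC : C.Nonempty),
      u B C = (B ×ˢ C).sup' (hB.product hC) (fun p => R p.1 p.2))
    (huE : ∀ A : Finset Θ, u A ∅ = 0 ∧ u ∅ A = 0) :
    (∀ B C : Finset Θ, (B ∩ C).Nonempty → u B C = 1) ∧
    (∀ B C : Finset Θ, u B C = u C B) ∧
    (∀ A B C : Finset Θ, B ⊆ C → u A B ≤ u A C) ∧
    (∀ A B C : Finset Θ, u A (B ∪ C) ≤ u A B + u A C) ∧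
    (∀ A : Finset Θ, u A ∅ = 0 ∧ u ∅ A = 0) ∧
    (∀ B C : Finset Θ, u B C ∈ Set.Icc (0 : ℝ) 1) := by
  have hmem : ∀ {B C : Finset Θ} {x y : Θ}, x ∈ B → y ∈ C → R x y ≤ u B C := by
    intro B C x y hx hy
    rw [hu B C ⟨x, hx⟩ ⟨y, hy⟩]
    exact Finset.le_sup' (fun p : Θ × Θ => R p.1 p.2) (Finset.mk_mem_product hx hy)
  have hle : ∀ {B C : Finset Θ} {t : ℝ}, 0 ≤ t → (∀ x ∈ B, ∀ y ∈ C, R x y ≤ t) → u B C ≤ t := by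
    intro B C t ht h
    rcases B.eq_empty_or_nonempty with rfl | hB
    · rwa [(huE C).2]
    rcases C.eq_empty_or_nonempty with rfl | hC
    · rwa [(huE B).1]
    rw [hu B C hB hC]
    refine Finset.sup'_le _ _ fun p hp => ?_
    rw [Finset.mem_product] at hp
    exact h p.1 hp.1 p.2 hp.2
  have hnonneg : ∀ B C : Finset Θ, 0 ≤ u B C := by
    intro B C
    rcases B.eq_empty_or_nonempty with rfl | ⟨x, hx⟩
    · exact (huE C).2.ge
    rcases C.eq_empty_or_nonempty with rfl | ⟨y, hy⟩
    · exact (huE B).1.ge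
    exact (hRrange x y).1.trans (hmem hx hy)
  have hle_one : ∀ B C : Finset Θ, u B C ≤ 1 := fun B C =>
    hle zero_le_one fun x _ y _ => (hRrange x y).2
  have hsymm_le : ∀ B C : Finset Θ, u B C ≤ u C B := fun B C =>
    hle (hnonneg C B) fun x hx y hy => (hRsymm x y).trans_le (hmem hy hx)
  refine ⟨?_, fun B C => (hsymm_le B C).antisymm (hsymm_le C B), ?_, ?_, huE,
    fun B C => ⟨hnonneg B C, hle_one B C⟩⟩
  · rintro B C ⟨x, hx⟩
    rw [Finset.mem_inter] at hx
    exact (hle_one B C).antisymm ((hRrefl x).ge.trans (hmem hx.1 hx.2))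
  · intro A B C hBC
    exact hle (hnonneg A C) fun x hx y hy => hmem hx (hBC hy)
  · intro A B C
    refine hle (add_nonneg (hnonneg A B) (hnonneg A C)) fun x hx y hy => ?_
    rcases Finset.mem_union.1 hy with hy | hy
    · exact (hmem hx hy).trans (le_add_of_nonneg_right (hnonneg A C))
    · exact (hmem hx hy).trans (le_add_of_nonneg_left (hnonneg A B))
end

section
/- Let Θ be a finite set with |Θ| ≥ 2 and let R assign to each pair of elements θi, θj ∈ Θ a real number R(θi,θj) ∈ [0,1] with R(θi,θj) = R(θj,θi), R(θ,θ) = 1, and R(θi,θj) ≠ 1 whenever θi ≠ θj. Define u(B,C) = max_{θi∈B, θj∈C} R(θi,θj) for nonempty B, C ⊆ Θ and u(B,∅) = u(∅,C) = 0. Then the (2^|Θ|−1)×(2^|Θ|−1) symmetric matrix U with entries u(B,C), indexed by the nonempty subsets B, C of Θ, has full rank. -/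
/-- There are `2 ^ |α| - 1` nonempty subsets of a finite type `α`. -/
theorem card_nonempty_finset (α : Type*) [Fintype α]
    [Fintype {A : Finset α // A.Nonempty}] :
    Fintype.card {A : Finset α // A.Nonempty} = 2 ^ Fintype.card α - 1 := by
  classical
  rw [Fintype.card_congr (Equiv.subtypeEquivRight
    fun A : Finset α => Finset.nonempty_iff_ne_empty (s := A))]
  simp [Fintype.card_subtype_compl]

/-- If `f B C` is supported on pairs `B ⊆ C` and `f B B ≠ 0`, then the rows of `f`, indexed by
nonempty sets, are linearly independent. -/
theorem eq_zero_of_sum_mul_eq_zero_of_subset {α : Type*} [Fintype α]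
    [Fintype {A : Finset α // A.Nonempty}]
    (f : Finset α → Finset α → ℝ)
    (hf : ∀ B C : Finset α, B.Nonempty → ¬ B ⊆ C → f B C = 0)
    (hdiag : ∀ B : Finset α, B.Nonempty → f B B ≠ 0)
    (v : {A : Finset α // A.Nonempty} → ℝ)
    (hv : ∀ C : {A : Finset α // A.Nonempty}, ∑ B, v B * f B.1 C.1 = 0) : v = 0 := by
  suffices ∀ (C : Finset α) (hC : C.Nonempty), v ⟨C, hC⟩ = 0 from funext fun C => this C.1 C.2
  intro C
  induction C using Finset.strongInduction with
  | H C ih =>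
    intro hC
    have h := hv ⟨C, hC⟩
    rw [Fintype.sum_eq_single ⟨C, hC⟩] at h
    · exact (mul_eq_zero.mp h).resolve_right (hdiag C hC)
    · rintro ⟨B, hB⟩ hne
      by_cases hBC : B ⊆ C
      · have hss : B ⊂ C := hBC.ssubset_of_ne fun h => hne (Subtype.ext h)
        rw [ih B hss hB, zero_mul]
      · rw [hf B C hB hBC, mul_zero]

/-- Let `Θ` be finite with `|Θ| ≥ 2` and let `R` be a symmetric, reflexive,
`[0,1]`-valued fuzzy relation on `Θ` with `R(θi,θj) ≠ 1` whenever `θi ≠ θj`. Define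
`u(B,C) = max_{θi ∈ B, θj ∈ C} R(θi,θj)` for nonempty `B, C ⊆ Θ` and `u(B,∅) = u(∅,C) = 0`.
Then the `(2^|Θ|−1) × (2^|Θ|−1)` matrix `U` with entries `u(B,C)`, indexed by the nonempty
subsets of `Θ`, has full rank. -/
theorem stmt_2 {Θ : Type*} [Fintype Θ] [DecidableEq Θ]
    (hcard : 2 ≤ Fintype.card Θ)
    (R : Θ → Θ → ℝ)
    (hRrange : ∀ x y : Θ, R x y ∈ Set.Icc (0 : ℝ) 1)
    (hRsymm : ∀ x y : Θ, R x y = R y x)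
    (hRrefl : ∀ x : Θ, R x x = 1)
    (hRne : ∀ x y : Θ, x ≠ y → R x y ≠ 1)
    (u : Finset Θ → Finset Θ → ℝ)
    (hu : ∀ (B C : Finset Θ) (hB : B.Nonempty) (hC : C.Nonempty),
      u B C = (B ×ˢ C).sup' (hB.product hC) (fun p => R p.1 p.2))
    (huE : ∀ A : Finset Θ, u A ∅ = 0 ∧ u ∅ A = 0)
    (U : Matrix {A : Finset Θ // A.Nonempty} {A : Finset Θ // A.Nonempty} ℝ)
    (hU : ∀ B C : {A : Finset Θ // A.Nonempty}, U B C = u B.1 C.1) :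
    U.rank = 2 ^ Fintype.card Θ - 1 := by
  have hle : ∀ B C : Finset Θ, u B C ≤ 1 := by
    intro B C
    rcases B.eq_empty_or_nonempty with rfl | hB
    · simp [(huE C).2]
    rcases C.eq_empty_or_nonempty with rfl | hC
    · simp [(huE B).1]
    rw [hu B C hB hC]
    exact Finset.sup'_le _ _ fun p _ => (hRrange p.1 p.2).2
  have hone : ∀ (B C : Finset Θ) (x : Θ), x ∈ B → x ∈ C → u B C = 1 := by
    intro B C x hB hC
    refine (hle B C).antisymm ?_
    rw [hu B C ⟨x, hB⟩ ⟨x, hC⟩, ← hRrefl x]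
    exact Finset.le_sup' (fun p : Θ × Θ => R p.1 p.2) (Finset.mk_mem_product hB hC)
  have hlt : ∀ B : Finset Θ, B.Nonempty → u B Bᶜ < 1 := by
    intro B hB
    rcases Bᶜ.eq_empty_or_nonempty with hE | hC
    · simp [hE, (huE B).1]
    rw [hu B Bᶜ hB hC, Finset.sup'_lt_iff]
    rintro ⟨x, y⟩ hp
    obtain ⟨hx, hy⟩ := Finset.mem_product.mp hp
    exact (hRrange x y).2.lt_of_ne
      (hRne x y fun h => Finset.mem_compl.mp hy (h ▸ hx))
  have hinj : Function.Injective U.vecMul := by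
    refine (injective_iff_map_eq_zero U.vecMulLinear).mpr fun v hv => ?_
    have hsum : ∀ C : Finset Θ, ∑ B, v B * u B.1 C = 0 := by
      intro C
      rcases C.eq_empty_or_nonempty with rfl | hC
      · simp [huE]
      · simpa [Matrix.vecMul, dotProduct, hU] using congrFun hv ⟨C, hC⟩
    have htotal : ∑ B, v B = 0 := by
      rw [← hsum Finset.univ]
      refine Finset.sum_congr rfl fun B _ => ?_
      obtain ⟨x, hx⟩ := B.2
      rw [hone B.1 Finset.univ x hx (Finset.mem_univ x), mul_one]
    refine eq_zero_of_sum_mul_eq_zero_of_subset (fun B C => 1 - u B Cᶜ) ?_ ?_ v ?_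
    · intro B C _ hBC
      obtain ⟨x, hx, hxC⟩ := Finset.not_subset.mp hBC
      exact sub_eq_zero.mpr (hone B Cᶜ x hx (Finset.mem_compl.mpr hxC)).symm
    · exact fun B hB => (sub_pos.mpr (hlt B hB)).ne'
    · intro C
      simp only [mul_sub, mul_one, Finset.sum_sub_distrib, htotal, hsum, sub_zero]
  rw [Matrix.rank_of_isUnit U (Matrix.vecMul_injective_iff_isUnit.mp hinj), card_nonempty_finset]
end

section
/- Let Θ be a finite nonempty set, u a non-exclusive degree on Θ, and D an information-complete D number on Θ. Then Bel(A) ≤ Pl(A) for every subset A ⊆ Θ. -/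
/-- For a non-exclusive degree `u` and an information-complete D number `D` on a
finite nonempty set `Θ`, `Bel(A) ≤ Pl(A)` for every `A ⊆ Θ`, where
`Bel(A) = Σ_{B ⊆ Θ} D(B)·(1 − u(B, Θ∖A))` and `Pl(A) = Σ_{B ⊆ Θ} u(B,A)·D(B)`. -/
theorem stmt_4 {Θ : Type*} [Fintype Θ] [DecidableEq Θ] [Nonempty Θ]
    (u : Finset Θ → Finset Θ → ℝ)
    (hRange : ∀ B C : Finset Θ, u B C ∈ Set.Icc (0 : ℝ) 1)
    (hP1 : ∀ B C : Finset Θ, (B ∩ C).Nonempty → u B C = 1)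
    (hP2 : ∀ B C : Finset Θ, u B C = u C B)
    (hP3 : ∀ A B C : Finset Θ, B ⊆ C → u A B ≤ u A C)
    (hP4 : ∀ A B C : Finset Θ, u A (B ∪ C) ≤ u A B + u A C)
    (hP5 : ∀ A : Finset Θ, u A ∅ = 0 ∧ u ∅ A = 0)
    (D : Finset Θ → ℝ)
    (hDrange : ∀ B : Finset Θ, D B ∈ Set.Icc (0 : ℝ) 1)
    (hDempty : D ∅ = 0)
    (hDsum : ∑ B : Finset Θ, D B = 1) :
    ∀ A : Finset Θ,
      (∑ B : Finset Θ, D B * (1 - u B Aᶜ)) ≤ ∑ B : Finset Θ, u B A * D B := by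
  intro A
  refine Finset.sum_le_sum fun B _ => ?_
  rcases B.eq_empty_or_nonempty with rfl | hB
  · simp [hDempty]
  · have hcover : u B (A ∪ Aᶜ) = 1 := hP1 _ _ (by simpa using hB)
    have hsub := hP4 B A Aᶜ
    rw [mul_comm (u B A)]
    exact mul_le_mul_of_nonneg_left (by linarith) (hDrange B).1
end

section
/- Let Θ be a finite nonempty set, u a non-exclusive degree on Θ, and D an information-complete D number on Θ. Then for every subset A ⊆ Θ: Bel(A) + Bel(Θ∖A) ≤ 1 and Pl(A) + Pl(Θ∖A) ≥ 1. -/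
/-- For a non-exclusive degree `u` and an information-complete D number `D` on a
finite nonempty set `Θ`, for every `A ⊆ Θ`: `Bel(A) + Bel(Θ∖A) ≤ 1` and
`Pl(A) + Pl(Θ∖A) ≥ 1`. -/
theorem stmt_7 {Θ : Type*} [Fintype Θ] [DecidableEq Θ] [Nonempty Θ]
    (u : Finset Θ → Finset Θ → ℝ)
    (hRange : ∀ B C : Finset Θ, u B C ∈ Set.Icc (0 : ℝ) 1)
    (hP1 : ∀ B C : Finset Θ, (B ∩ C).Nonempty → u B C = 1)
    (hP2 : ∀ B C : Finset Θ, u B C = u C B)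
    (hP3 : ∀ A B C : Finset Θ, B ⊆ C → u A B ≤ u A C)
    (hP4 : ∀ A B C : Finset Θ, u A (B ∪ C) ≤ u A B + u A C)
    (hP5 : ∀ A : Finset Θ, u A ∅ = 0 ∧ u ∅ A = 0)
    (D : Finset Θ → ℝ)
    (hDrange : ∀ B : Finset Θ, D B ∈ Set.Icc (0 : ℝ) 1)
    (hDempty : D ∅ = 0)
    (hDsum : ∑ B : Finset Θ, D B = 1) :
    ∀ A : Finset Θ,
      (∑ B : Finset Θ, D B * (1 - u B Aᶜ)) + (∑ B : Finset Θ, D B * (1 - u B Aᶜᶜ)) ≤ 1 ∧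
      1 ≤ (∑ B : Finset Θ, u B A * D B) + (∑ B : Finset Θ, u B Aᶜ * D B) := by
  intro A
  have hle : ∀ B : Finset Θ, D B ≤ u B A * D B + u B Aᶜ * D B := by
    intro B
    rcases B.eq_empty_or_nonempty with rfl | hB
    · simp [hDempty]
    · have hcover : u B (A ∪ Aᶜ) = 1 := hP1 B _ (by simpa using hB)
      have hone : 1 ≤ u B A + u B Aᶜ := hcover ▸ hP4 B A Aᶜ
      rw [← add_mul]
      exact le_mul_of_one_le_left (hDrange B).1 hone
  have hPl : 1 ≤ (∑ B : Finset Θ, u B A * D B) + ∑ B : Finset Θ, u B Aᶜ * D B := by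
    rw [← hDsum, ← Finset.sum_add_distrib]
    exact Finset.sum_le_sum fun B _ => hle B
  have hBel : ∀ C : Finset Θ,
      ∑ B : Finset Θ, D B * (1 - u B C) = 1 - ∑ B : Finset Θ, u B C * D B := by
    intro C
    simp only [mul_one_sub, Finset.sum_sub_distrib, hDsum, mul_comm]
  refine ⟨?_, hPl⟩
  rw [hBel, hBel, compl_compl]
  linarith
end

section
/- Let Θ be a finite nonempty set, u a non-exclusive degree on Θ, and D an information-complete D number on Θ. If A ⊆ B ⊆ Θ, then Bel(A) ≤ Bel(B) and Pl(A) ≤ Pl(B). -/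
/-- For a non-exclusive degree `u` and an information-complete D number `D` on a
finite nonempty set `Θ`, if `A ⊆ B ⊆ Θ`, then `Bel(A) ≤ Bel(B)` and `Pl(A) ≤ Pl(B)`. -/
theorem stmt_8 {Θ : Type*} [Fintype Θ] [DecidableEq Θ] [Nonempty Θ]
    (u : Finset Θ → Finset Θ → ℝ)
    (hRange : ∀ B C : Finset Θ, u B C ∈ Set.Icc (0 : ℝ) 1)
    (hP1 : ∀ B C : Finset Θ, (B ∩ C).Nonempty → u B C = 1)
    (hP2 : ∀ B C : Finset Θ, u B C = u C B)
    (hP3 : ∀ A B C : Finset Θ, B ⊆ C → u A B ≤ u A C)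
    (hP4 : ∀ A B C : Finset Θ, u A (B ∪ C) ≤ u A B + u A C)
    (hP5 : ∀ A : Finset Θ, u A ∅ = 0 ∧ u ∅ A = 0)
    (D : Finset Θ → ℝ)
    (hDrange : ∀ B : Finset Θ, D B ∈ Set.Icc (0 : ℝ) 1)
    (hDempty : D ∅ = 0)
    (hDsum : ∑ B : Finset Θ, D B = 1) :
    ∀ A B : Finset Θ, A ⊆ B →
      (∑ C : Finset Θ, D C * (1 - u C Aᶜ)) ≤ (∑ C : Finset Θ, D C * (1 - u C Bᶜ)) ∧
      (∑ C : Finset Θ, u C A * D C) ≤ (∑ C : Finset Θ, u C B * D C) := by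
  intro A B hAB
  refine ⟨Finset.sum_le_sum fun C _ => ?_, Finset.sum_le_sum fun C _ => ?_⟩
  · exact mul_le_mul_of_nonneg_left
      (sub_le_sub_left (hP3 C _ _ (Finset.compl_subset_compl.mpr hAB)) 1) (hDrange C).1
  · exact mul_le_mul_of_nonneg_right (hP3 C A B hAB) (hDrange C).1
end

section
/- For all real numbers Q1, Q2, δ ∈ [0,1] and K1 with 0 ≤ K1 ≤ Q1·Q2, one has K1 + K2 ≤ 1, where K2 = D1X + D2X − 2·D1X·D2X with D1X = (1−δ)(1−Q1) and D2X = (1−δ)(1−Q2). (Hence the denominator 1 − K_D = 1 − K1 − K2 appearing in the combination of information-incomplete D numbers is nonnegative.) -/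
/-- For all `Q1, Q2, δ ∈ [0,1]` and `0 ≤ K1 ≤ Q1·Q2`, one has `K1 + K2 ≤ 1`,
where `K2 = D1X + D2X − 2·D1X·D2X` with `D1X = (1−δ)(1−Q1)` and `D2X = (1−δ)(1−Q2)`. -/
theorem stmt_13 (Q1 Q2 δ K1 : ℝ)
    (hQ1 : Q1 ∈ Set.Icc (0 : ℝ) 1) (hQ2 : Q2 ∈ Set.Icc (0 : ℝ) 1)
    (hδ : δ ∈ Set.Icc (0 : ℝ) 1)
    (hK1 : 0 ≤ K1) (hK1' : K1 ≤ Q1 * Q2)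
    (D1X D2X K2 : ℝ)
    (hD1X : D1X = (1 - δ) * (1 - Q1))
    (hD2X : D2X = (1 - δ) * (1 - Q2))
    (hK2 : K2 = D1X + D2X - 2 * D1X * D2X) :
    K1 + K2 ≤ 1 := by
  obtain ⟨hQ1_nonneg, hQ1_le⟩ := hQ1
  obtain ⟨hQ2_nonneg, hQ2_le⟩ := hQ2
  obtain ⟨hδ_nonneg, hδ_le⟩ := hδ
  have hD1_nonneg : 0 ≤ D1X := hD1X ▸ mul_nonneg (by linarith) (by linarith)
  have hD2_nonneg : 0 ≤ D2X := hD2X ▸ mul_nonneg (by linarith) (by linarith)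
  have hQ1_le_compl : Q1 ≤ 1 - D1X := by
    linarith [mul_nonneg hδ_nonneg (sub_nonneg.mpr hQ1_le)]
  have hQ2_le_compl : Q2 ≤ 1 - D2X := by
    linarith [mul_nonneg hδ_nonneg (sub_nonneg.mpr hQ2_le)]
  have hprod : Q1 * Q2 ≤ (1 - D1X) * (1 - D2X) :=
    mul_le_mul hQ1_le_compl hQ2_le_compl hQ2_nonneg (hQ1_nonneg.trans hQ1_le_compl)
  calc K1 + K2 ≤ (1 - D1X) * (1 - D2X) + (D1X + D2X - 2 * D1X * D2X) := by linarith
    _ = 1 - D1X * D2X := by ring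
    _ ≤ 1 := by linarith [mul_nonneg hD1_nonneg hD2_nonneg]
end

section
/- (DX is nonincreasing in δ.) Fix real numbers Q1, Q2 ∈ [0,1] and K1 with 0 ≤ K1 ≤ Q1·Q2. For δ ∈ [0,1] define DX(δ) = D1X(δ)·D2X(δ)/(1−K_D(δ)), where D1X(δ) = (1−δ)(1−Q1), D2X(δ) = (1−δ)(1−Q2), K_D(δ) = K1 + D1X(δ) + D2X(δ) − 2·D1X(δ)·D2X(δ). If δ ≤ δ' in [0,1] and 1−K_D(δ) > 0 and 1−K_D(δ') > 0, then DX(δ) ≥ DX(δ'). Moreover DX(1) = 0, and if 1−K_D(0) > 0 then DX(0) = (1−Q1)(1−Q2)/(1 − K1 − Q1(1−Q2) − Q2(1−Q1)). -/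
/-- DX is nonincreasing in δ: Fix `Q1, Q2 ∈ [0,1]` and `0 ≤ K1 ≤ Q1·Q2`. For
`δ ∈ [0,1]` let `D1X(δ) = (1−δ)(1−Q1)`, `D2X(δ) = (1−δ)(1−Q2)`,
`K_D(δ) = K1 + D1X(δ) + D2X(δ) − 2·D1X(δ)·D2X(δ)`, and
`DX(δ) = D1X(δ)·D2X(δ)/(1−K_D(δ))`. If `δ ≤ δ'` in `[0,1]` and both denominators
`1−K_D(δ)`, `1−K_D(δ')` are positive, then `DX(δ) ≥ DX(δ')`. Moreover `DX(1) = 0`, and if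
`1−K_D(0) > 0` then `DX(0) = (1−Q1)(1−Q2)/(1 − K1 − Q1(1−Q2) − Q2(1−Q1))`. -/
theorem stmt_16 (Q1 Q2 K1 : ℝ)
    (hQ1 : Q1 ∈ Set.Icc (0 : ℝ) 1) (hQ2 : Q2 ∈ Set.Icc (0 : ℝ) 1)
    (hK1 : 0 ≤ K1) (hK1' : K1 ≤ Q1 * Q2)
    (D1X D2X KD DX : ℝ → ℝ)
    (hD1X : ∀ δ : ℝ, D1X δ = (1 - δ) * (1 - Q1))
    (hD2X : ∀ δ : ℝ, D2X δ = (1 - δ) * (1 - Q2))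
    (hKD : ∀ δ : ℝ, KD δ = K1 + D1X δ + D2X δ - 2 * D1X δ * D2X δ)
    (hDX : ∀ δ : ℝ, DX δ = D1X δ * D2X δ / (1 - KD δ)) :
    (∀ δ δ' : ℝ, δ ∈ Set.Icc (0 : ℝ) 1 → δ' ∈ Set.Icc (0 : ℝ) 1 → δ ≤ δ' →
      0 < 1 - KD δ → 0 < 1 - KD δ' → DX δ' ≤ DX δ) ∧
    DX 1 = 0 ∧
    (0 < 1 - KD 0 →
      DX 0 = (1 - Q1) * (1 - Q2) / (1 - K1 - Q1 * (1 - Q2) - Q2 * (1 - Q1))) := by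
  obtain ⟨hQ1, hQ1'⟩ := hQ1
  obtain ⟨hQ2, hQ2'⟩ := hQ2
  refine ⟨?_, ?_, fun _ => ?_⟩
  · rintro δ δ' ⟨hδ, hδ1⟩ ⟨hδ', hδ1'⟩ hle hpos hpos'
    rw [hDX, hDX, div_le_div_iff₀ hpos' hpos]
    simp only [hKD, hD1X, hD2X]
    have hK : ((1 - Q1) + (1 - Q2)) / 2 ≤ 1 - K1 := by
      nlinarith [mul_nonneg hQ1 (sub_nonneg.2 hQ2'), mul_nonneg hQ2 (sub_nonneg.2 hQ1')]
    have hst : (1 - δ) * (1 - δ') ≤ ((1 - δ) + (1 - δ')) / 2 := by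
      nlinarith [mul_nonneg hδ (sub_nonneg.2 hδ1'), mul_nonneg hδ' (sub_nonneg.2 hδ1)]
    have hsum : 0 ≤ ((1 - δ) + (1 - δ')) * (1 - K1)
        - (1 - δ) * (1 - δ') * ((1 - Q1) + (1 - Q2)) := by
      have h₁ := mul_le_mul_of_nonneg_left hK (by linarith : 0 ≤ (1 - δ) + (1 - δ'))
      have h₂ := mul_le_mul_of_nonneg_right hst (by linarith : 0 ≤ (1 - Q1) + (1 - Q2))
      linarith
    have hprod := mul_nonneg (mul_nonneg
      (mul_nonneg (sub_nonneg.2 hQ1') (sub_nonneg.2 hQ2')) (sub_nonneg.2 hle)) hsum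
    linear_combination hprod
  · simp [hDX, hD1X]
  · simp only [hDX, hKD, hD1X, hD2X]
    congr 1 <;> ring
end

section
/- (DX is nonincreasing in Q1.) Fix real numbers Q2, δ ∈ [0,1] and K1 ≥ 0. For Q1 ∈ [0,1] with K1 ≤ Q1·Q2, define DX(Q1) = D1X·D2X/(1−K_D), where D1X = (1−δ)(1−Q1), D2X = (1−δ)(1−Q2), K_D = K1 + D1X + D2X − 2·D1X·D2X. If Q1 ≤ Q1' in [0,1], K1 ≤ Q1·Q2, and the denominators 1−K_D are positive at both Q1 and Q1', then DX(Q1) ≥ DX(Q1'). In particular DX(1) = 0 (when its denominator is positive), and by symmetry DX is also nonincreasing in Q2. -/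
/-- For fixed `y ≥ 0` with `c + y ≤ 1`, the map `x ↦ x y / (1 - (c + x + y - 2 x y))` is
monotone where its denominator is positive. -/
theorem mul_div_one_sub_le_mul_div_one_sub {c x x' y : ℝ} (hy : 0 ≤ y) (hcy : c + y ≤ 1)
    (hx : x' ≤ x) (hd : 0 < 1 - (c + x + y - 2 * x * y))
    (hd' : 0 < 1 - (c + x' + y - 2 * x' * y)) :
    x' * y / (1 - (c + x' + y - 2 * x' * y)) ≤ x * y / (1 - (c + x + y - 2 * x * y)) := by
  rw [div_le_div_iff₀ hd' hd]
  linear_combination mul_nonneg (mul_nonneg hy (sub_nonneg.2 hx)) (sub_nonneg.2 hcy)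

/-- If `c ≤ p q` with `p ≤ 1`, then `c + t (1 - q) ≤ 1` for all `t ≤ 1`. -/
theorem add_mul_one_sub_le_one {c p q t : ℝ} (ht : t ≤ 1) (hp : p ≤ 1)
    (hq : q ∈ Set.Icc (0 : ℝ) 1) (hc : c ≤ p * q) : c + t * (1 - q) ≤ 1 := by
  have h₁ := mul_le_of_le_one_left hq.1 hp
  have h₂ := mul_le_of_le_one_left (sub_nonneg.2 hq.2) ht
  linarith


/-- DX is nonincreasing in Q1, and by symmetry in Q2: Fix `δ ∈ [0,1]` and
`K1 ≥ 0`. For `q1, q2 ∈ [0,1]` let `D1X(q1) = (1−δ)(1−q1)`, `D2X(q2) = (1−δ)(1−q2)`,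
`K_D(q1,q2) = K1 + D1X(q1) + D2X(q2) − 2·D1X(q1)·D2X(q2)`, and
`DX(q1,q2) = D1X(q1)·D2X(q2)/(1−K_D(q1,q2))`. If `q1 ≤ q1'` in `[0,1]`, `K1 ≤ q1·q2`, and
both denominators are positive, then `DX(q1,q2) ≥ DX(q1',q2)`; `DX(1,q2) = 0` whenever its
denominator is positive; and symmetrically `DX` is nonincreasing in `q2`. -/
theorem stmt_17 (δ K1 : ℝ)
    (hδ : δ ∈ Set.Icc (0 : ℝ) 1) (hK1 : 0 ≤ K1)
    (D1X D2X : ℝ → ℝ) (KD DX : ℝ → ℝ → ℝ)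
    (hD1X : ∀ q1 : ℝ, D1X q1 = (1 - δ) * (1 - q1))
    (hD2X : ∀ q2 : ℝ, D2X q2 = (1 - δ) * (1 - q2))
    (hKD : ∀ q1 q2 : ℝ, KD q1 q2 = K1 + D1X q1 + D2X q2 - 2 * D1X q1 * D2X q2)
    (hDX : ∀ q1 q2 : ℝ, DX q1 q2 = D1X q1 * D2X q2 / (1 - KD q1 q2)) :
    (∀ q1 q1' q2 : ℝ, q1 ∈ Set.Icc (0 : ℝ) 1 → q1' ∈ Set.Icc (0 : ℝ) 1 →
      q2 ∈ Set.Icc (0 : ℝ) 1 → q1 ≤ q1' → K1 ≤ q1 * q2 →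
      0 < 1 - KD q1 q2 → 0 < 1 - KD q1' q2 → DX q1' q2 ≤ DX q1 q2) ∧
    (∀ q2 : ℝ, q2 ∈ Set.Icc (0 : ℝ) 1 → 0 < 1 - KD 1 q2 → DX 1 q2 = 0) ∧
    (∀ q1 q2 q2' : ℝ, q1 ∈ Set.Icc (0 : ℝ) 1 → q2 ∈ Set.Icc (0 : ℝ) 1 →
      q2' ∈ Set.Icc (0 : ℝ) 1 → q2 ≤ q2' → K1 ≤ q1 * q2 →
      0 < 1 - KD q1 q2 → 0 < 1 - KD q1 q2' → DX q1 q2' ≤ DX q1 q2) := by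
  have hδ₀ : 0 ≤ 1 - δ := sub_nonneg.2 hδ.2
  have hδ₁ : 1 - δ ≤ 1 := sub_le_self 1 hδ.1
  simp only [hDX, hKD, hD1X, hD2X]
  refine ⟨fun q1 q1' q2 h1 _ h2 hle hK hd hd' => ?_, fun q2 _ _ => by simp,
    fun q1 q2 q2' h1 h2 _ hle hK hd hd' => ?_⟩
  · exact mul_div_one_sub_le_mul_div_one_sub (mul_nonneg hδ₀ (sub_nonneg.2 h2.2))
      (add_mul_one_sub_le_one hδ₁ h1.2 h2 hK)
      (mul_le_mul_of_nonneg_left (sub_le_sub_left hle 1) hδ₀) hd hd'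
  · have key := mul_div_one_sub_le_mul_div_one_sub (c := K1)
      (mul_nonneg hδ₀ (sub_nonneg.2 h1.2))
      (add_mul_one_sub_le_one hδ₁ h2.2 h1 (by linarith))
      (mul_le_mul_of_nonneg_left (sub_le_sub_left hle 1) hδ₀) (by linarith) (by linarith)
    convert key using 2 <;> ring
end
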